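/- arXiv:1512.02364 — 2 statements merged into one kernel-verified Lean document; each statement's English description precedes it below -/
import Mathlib

section
/- For every $n \in \mathbb{N}$ and every real $x$, $S_{n,-1}(x) = \sum_{k=0}^n 4^{k-n} \binom{2n}{n} \binom{n}{k}^2 \binom{2n}{2k}^{-1} \left(x-\frac{1}{2}\right)^{2k}$. -/
/-- `S_{n,-1}(x) = ∑_{k=0}^n (C(n,k) xᵏ (1-x)^{n-k})²`. -/
noncomputable def Sb (n : ℕ) (x : ℝ) : ℝ :=
  ∑ k ∈ Finset.range (n + 1),
    ((Nat.choose n k : ℝ) * x ^ k * (1 - x) ^ (n - k)) ^ 2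

open Polynomial in
/-- The constant term of `(s + 2 + s⁻¹)ᵏ (2 - s - s⁻¹)ᵐ`, a discrete Beta integral. -/
lemma coeff_one_add_X_sq_pow_mul_neg_one_sub_X_sq_pow (m k : ℕ) :
    (((1 + X : ℝ[X]) ^ 2) ^ k * (-(1 - X) ^ 2) ^ m).coeff (k + m)
      = ((2 * k).factorial * (2 * m).factorial : ℝ)
        / (k.factorial * m.factorial * (k + m).factorial) := by
  induction m generalizing k with
  | zero =>
    have h : (((1 + X : ℝ[X]) ^ 2) ^ k).coeff k = ((2 * k).choose k : ℝ) := by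
      rw [← pow_mul, coeff_one_add_X_pow]
    rw [pow_zero, mul_one, add_zero, h, Nat.cast_choose ℝ (by omega : k ≤ 2 * k),
      show 2 * k - k = k by omega]
    simp
  | succ m ih =>
    have key : ((1 + X : ℝ[X]) ^ 2) ^ k * (-(1 - X) ^ 2) ^ (m + 1)
        = C 4 * (((1 + X) ^ 2) ^ k * (-(1 - X) ^ 2) ^ m * X)
          - ((1 + X) ^ 2) ^ (k + 1) * (-(1 - X) ^ 2) ^ m := by
      rw [show (C 4 : ℝ[X]) = 4 from rfl]
      ring
    have h := ih (k + 1)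
    rw [key, coeff_sub, coeff_C_mul, ← add_assoc k m 1, coeff_mul_X, ih k,
      show k + m + 1 = k + 1 + m by omega, h, show k + 1 + m = k + m + 1 by omega,
      show 2 * (k + 1) = 2 * k + 1 + 1 by ring, show 2 * (m + 1) = 2 * m + 1 + 1 by ring]
    simp only [Nat.factorial_succ]
    push_cast
    have h1 := Nat.cast_add_one_ne_zero (R := ℝ) k
    have h2 := Nat.cast_add_one_ne_zero (R := ℝ) m
    have h3 : (k + m + 1 : ℝ) ≠ 0 := by positivity
    field_simp
    ring

open Polynomial in
lemma coeff_C_mul_X_add_C_pow {R : Type*} [CommSemiring R] (a b : R) (n k : ℕ) :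
    ((C a * X + C b) ^ n).coeff k = n.choose k * a ^ k * b ^ (n - k) := by
  have h : (C a * X + C b) ^ n = ((X + C b) ^ n).comp (C a * X) := by simp
  rw [h, comp_C_mul_X_coeff, coeff_X_add_C_pow]
  ring

open Polynomial in
lemma Sb_eq_coeff (n : ℕ) (x : ℝ) :
    Sb n x = (((C x * X + C (1 - x)) * (C (1 - x) * X + C x)) ^ n).coeff n := by
  rw [mul_pow, coeff_mul, Finset.Nat.sum_antidiagonal_eq_sum_range_succ_mk, Sb]
  refine Finset.sum_congr rfl fun k hk => ?_
  have hk' : k ≤ n := by simpa [Nat.lt_succ_iff] using hk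
  simp only [coeff_C_mul_X_add_C_pow]
  rw [Nat.choose_symm hk', Nat.sub_sub_self hk']
  ring

open Polynomial in
lemma product_eq_half_angle_form (x : ℝ) :
    (C x * X + C (1 - x)) * (C (1 - x) * X + C x)
      = C ((x - 1 / 2) ^ 2) * (-(1 - X) ^ 2) + C (4⁻¹) * (1 + X) ^ 2 := by
  have h : (C (4⁻¹ : ℝ) : ℝ[X]) * 4 = 1 := by
    rw [show (4 : ℝ[X]) = C 4 from rfl, ← C_mul]
    norm_num
  have h' : (C ((x - 1 / 2) ^ 2) : ℝ[X]) = C x ^ 2 - C x + C (4⁻¹) := by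
    rw [← C_pow, ← C_sub, ← C_add]
    congr 1
    ring
  rw [h', C_sub, C_1]
  linear_combination (-X) * h

theorem stmt15 (n : ℕ) (hn : 0 < n) (x : ℝ) :
    Sb n x = ∑ k ∈ Finset.range (n + 1),
      (4 : ℝ) ^ ((k : ℤ) - (n : ℤ)) * (Nat.choose (2 * n) n : ℝ)
        * (Nat.choose n k : ℝ) ^ 2 * (Nat.choose (2 * n) (2 * k) : ℝ)⁻¹
        * (x - 1 / 2) ^ (2 * k) := by
  rw [Sb_eq_coeff, product_eq_half_angle_form, add_pow, Polynomial.finsetSum_coeff]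
  refine Finset.sum_congr rfl fun k hk => ?_
  obtain ⟨m, rfl⟩ := Nat.exists_eq_add_of_le (Nat.lt_succ_iff.mp (Finset.mem_range.mp hk))
  have hB := coeff_one_add_X_sq_pow_mul_neg_one_sub_X_sq_pow k m
  rw [add_comm m k] at hB
  rw [Nat.add_sub_cancel_left, mul_pow, mul_pow, ← Polynomial.C_pow, ← Polynomial.C_pow,
    ← Polynomial.C_eq_natCast]
  have hrw (a b c : ℝ) (p q : Polynomial ℝ) :
      Polynomial.C a * p * (Polynomial.C b * q) * Polynomial.C c
        = Polynomial.C (a * b * c) * (q * p) := by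
    simp only [Polynomial.C_mul]
    ring
  have h4 : (4 : ℝ) ^ ((k : ℤ) - ((k + m : ℕ) : ℤ)) = 4⁻¹ ^ m := by
    rw [show (k : ℤ) - ((k + m : ℕ) : ℤ) = -(m : ℤ) by push_cast; ring, zpow_neg, zpow_natCast,
      inv_pow]
  rw [hrw, Polynomial.coeff_C_mul, hB, h4,
    Nat.cast_choose ℝ (by omega : k + m ≤ 2 * (k + m)), Nat.cast_choose ℝ (by omega : k ≤ k + m),
    Nat.cast_choose ℝ (by omega : 2 * k ≤ 2 * (k + m)),
    show 2 * (k + m) - (k + m) = k + m by omega, show k + m - k = m by omega,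
    show 2 * (k + m) - 2 * k = 2 * m by omega, ← pow_mul]
  field_simp
end

section
/- For every $n \in \mathbb{N}$ and every integer $j$ with $0 \le j \le n$, the $2j$-th derivative of $S_{n,-1}$ at $\frac{1}{2}$ equals $S^{(2j)}_{n,-1}\left(\frac{1}{2}\right) = (2j)!\, 4^{j-n} \binom{2n}{n} \binom{n}{j}^2 \binom{2n}{2j}^{-1}$; in particular $S^{(2j)}_{n,-1}\left(\frac{1}{2}\right) > 0$ for $j = 0, 1, \dots, n$. -/
open Polynomial in
/-- The von Szily identity for the central coefficient of `(1 + X) ^ (2a) (1 - X) ^ (2b)`. -/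
theorem coeff_one_add_X_pow_mul_one_sub_X_pow (a b : ℕ) :
    (((1 + X) ^ (2 * a) * (1 - X) ^ (2 * b) : ℝ[X]).coeff (a + b))
      * ((a.factorial : ℝ) * b.factorial * (a + b).factorial)
      = (-1) ^ b * ((2 * a).factorial * (2 * b).factorial) := by
  induction b generalizing a with
  | zero =>
    have h := Nat.choose_mul_factorial_mul_factorial (n := 2 * a) (k := a) (by omega)
    have h2 : 2 * a - a = a := by omega
    rw [h2] at h
    simp only [Nat.mul_zero, pow_zero, mul_one, add_zero, coeff_one_add_X_pow,
      Nat.factorial_zero, Nat.cast_one, one_mul]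
    rw [← h]
    push_cast
    ring
  | succ b ih =>
    have key : (1 + X) ^ (2 * a) * (1 - X) ^ (2 * (b + 1))
        = (1 + X) ^ (2 * (a + 1)) * (1 - X) ^ (2 * b)
          - C 4 * ((1 + X) ^ (2 * a) * (1 - X) ^ (2 * b) * X : ℝ[X]) := by
      have h4 : (C 4 : ℝ[X]) = 4 := rfl
      rw [h4]
      ring
    have h1 := ih (a + 1)
    have h0 := ih a
    have e : a + 1 + b = a + b + 1 := by ring
    rw [e] at h1
    rw [key, ← add_assoc, coeff_sub, coeff_C_mul, coeff_mul_X]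
    generalize ((1 + X) ^ (2 * (a + 1)) * (1 - X) ^ (2 * b) : ℝ[X]).coeff (a + b + 1) = u at *
    generalize ((1 + X) ^ (2 * a) * (1 - X) ^ (2 * b) : ℝ[X]).coeff (a + b) = v at *
    have ea : 2 * (a + 1) = 2 * a + 1 + 1 := by ring
    have eb : 2 * (b + 1) = 2 * b + 1 + 1 := by ring
    rw [ea] at h1
    rw [eb]
    simp only [Nat.factorial_succ] at h1 ⊢
    push_cast at h1 ⊢
    have ha : (a : ℝ) + 1 ≠ 0 := by positivity
    apply mul_left_cancel₀ ha
    rw [pow_succ]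
    linear_combination (b + 1 : ℝ) * h1 - 4 * (a + 1 : ℝ) * (b + 1) * (a + b + 1) * h0

open Polynomial in
theorem sum_sq_choose_eq_coeff (n : ℕ) (p q : ℝ) :
    ∑ k ∈ Finset.range (n + 1), ((n.choose k : ℝ) * p ^ k * q ^ (n - k)) ^ 2
      = (((C q + C p * X) * (C p + C q * X)) ^ n).coeff n := by
  have hc : ∀ (u v : ℝ) (m : ℕ), ((C u + C v * X) ^ n).coeff m
      = v ^ m * u ^ (n - m) * n.choose m := by
    intro u v m
    have : (C u + C v * X) ^ n = ((X + C u) ^ n).comp (C v * X) := by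
      simp [add_comm]
    rw [this, comp_C_mul_X_coeff, coeff_X_add_C_pow]
    ring
  rw [mul_pow, coeff_mul, Finset.Nat.sum_antidiagonal_eq_sum_range_succ_mk]
  refine Finset.sum_congr rfl fun k hk => ?_
  have hk : k ≤ n := Nat.lt_succ_iff.mp (Finset.mem_range.mp hk)
  rw [hc, hc, Nat.choose_symm hk, Nat.sub_sub_self hk]
  ring

theorem choose_mul_sq_div_choose {n j : ℕ} (hj : j ≤ n) :
    ((2 * n).choose n : ℝ) * (n.choose j : ℝ) ^ 2 * ((2 * n).choose (2 * j) : ℝ)⁻¹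
      = (2 * j).factorial * (2 * (n - j)).factorial
        / ((j.factorial : ℝ) ^ 2 * ((n - j).factorial : ℝ) ^ 2) := by
  have e1 : 2 * n - n = n := by omega
  have e2 : 2 * n - 2 * j = 2 * (n - j) := by omega
  rw [Nat.cast_choose ℝ (show n ≤ 2 * n by omega), Nat.cast_choose ℝ hj,
    Nat.cast_choose ℝ (show 2 * j ≤ 2 * n by omega), e1, e2]
  field_simp

open Polynomial in
theorem Sb_eq_sum (n : ℕ) (x : ℝ) :
    Sb n x = ∑ j ∈ Finset.range (n + 1),
      ((4 : ℝ) ^ ((j : ℤ) - (n : ℤ)) * (((2 * n).choose n : ℝ) * (n.choose j : ℝ) ^ 2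
        * ((2 * n).choose (2 * j) : ℝ)⁻¹)) * (x - 1 / 2) ^ (2 * j) := by
  have hpoly : (C (1 - x) + C x * X) * (C x + C (1 - x) * X)
      = C (1 / 4) * (C (-(4 * (x - 1 / 2) ^ 2)) * (1 - X) ^ 2 + (1 + X) ^ 2) := by
    have h : (C (1 - x) + C x * X) * (C x + C (1 - x) * X)
      = C (x * (1 - x)) * (1 + X ^ 2) + C (x ^ 2 + (1 - x) ^ 2) * X := by
      simp only [C_mul, C_add, C_pow]
      ring
    have h' : C (1 / 4) * (C (-(4 * (x - 1 / 2) ^ 2)) * (1 - X) ^ 2 + (1 + X) ^ 2)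
      = C (1 / 4 * (1 - 4 * (x - 1 / 2) ^ 2)) * (1 + X ^ 2)
        + C (1 / 4 * (2 + 2 * (4 * (x - 1 / 2) ^ 2))) * X := by
      simp only [C_mul, C_add, C_pow, C_neg, C_sub, C_1, show (C 2 : ℝ[X]) = 2 from rfl]
      ring
    rw [h, h']
    have e₁ : x * (1 - x) = 1 / 4 * (1 - 4 * (x - 1 / 2) ^ 2) := by ring
    have e₂ : x ^ 2 + (1 - x) ^ 2 = 1 / 4 * (2 + 2 * (4 * (x - 1 / 2) ^ 2)) := by ring
    rw [e₁, e₂]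
  rw [Sb, sum_sq_choose_eq_coeff, hpoly, mul_pow, ← C_pow, coeff_C_mul, add_pow, finsetSum_coeff,
    Finset.mul_sum]
  refine Finset.sum_congr rfl fun j hj => ?_
  have hj : j ≤ n := Nat.lt_succ_iff.mp (Finset.mem_range.mp hj)
  have hterm : (C (-(4 * (x - 1 / 2) ^ 2)) * (1 - X) ^ 2) ^ j * ((1 + X) ^ 2) ^ (n - j)
        * (n.choose j : ℝ[X])
      = C ((-(4 * (x - 1 / 2) ^ 2)) ^ j * n.choose j)
        * ((1 + X) ^ (2 * (n - j)) * (1 - X) ^ (2 * j)) := by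
    rw [mul_pow, ← pow_mul, ← pow_mul, C_mul, C_pow, C_eq_natCast]
    ring
  have hB := coeff_one_add_X_pow_mul_one_sub_X_pow (n - j) j
  rw [Nat.sub_add_cancel hj] at hB
  rw [hterm, coeff_C_mul, choose_mul_sq_div_choose hj, Nat.cast_choose ℝ hj,
    zpow_sub₀ (by norm_num), zpow_natCast, zpow_natCast]
  generalize ((1 + X) ^ (2 * (n - j)) * (1 - X) ^ (2 * j) : ℝ[X]).coeff n = B at *
  have hB' : B = (-1) ^ j * ((2 * (n - j)).factorial * (2 * j).factorial)
      / ((n - j).factorial * j.factorial * n.factorial) := by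
    rw [eq_div_iff (by positivity), hB]
  have hs : ((-1 : ℝ) ^ j) * (-1) ^ j = 1 := by
    rw [← mul_pow]
    simp
  rw [hB', neg_pow, mul_pow, pow_mul, one_div, inv_pow]
  field_simp
  linear_combination ((x - 1 / 2) ^ 2) ^ j * hs

open Polynomial in
theorem iteratedDeriv_eval_sub (P : ℝ[X]) (c : ℝ) (m : ℕ) :
    iteratedDeriv m (fun x => P.eval (x - c)) c = m.factorial * P.coeff m := by
  have h : ∀ k : ℕ, iteratedDeriv k (fun x => P.eval (x - c))
      = fun x => (derivative^[k] P).eval (x - c) := by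
    intro k
    induction k with
    | zero => simp
    | succ k ih =>
      funext x
      rw [iteratedDeriv_succ, ih, Function.iterate_succ_apply',
        deriv_comp_sub_const (f := fun y => (derivative^[k] P).eval y), Polynomial.deriv]
  rw [h]
  simp only [sub_self]
  rw [← coeff_zero_eq_eval_zero, coeff_iterate_derivative, zero_add, Nat.descFactorial_self,
    nsmul_eq_mul]

open Polynomial in
theorem iteratedDeriv_two_mul_Sb {n j : ℕ} (hj : j ≤ n) :
    iteratedDeriv (2 * j) (Sb n) (1 / 2)
      = (Nat.factorial (2 * j) : ℝ) * (4 : ℝ) ^ ((j : ℤ) - (n : ℤ))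
        * (Nat.choose (2 * n) n : ℝ) * (Nat.choose n j : ℝ) ^ 2
        * (Nat.choose (2 * n) (2 * j) : ℝ)⁻¹ := by
  set c : ℕ → ℝ := fun i => (4 : ℝ) ^ ((i : ℤ) - (n : ℤ)) * (((2 * n).choose n : ℝ)
    * (n.choose i : ℝ) ^ 2 * ((2 * n).choose (2 * i) : ℝ)⁻¹) with hc
  have hS : Sb n = fun x =>
      (∑ i ∈ Finset.range (n + 1), C (c i) * X ^ (2 * i)).eval (x - 1 / 2) := by
    funext x
    simp [Sb_eq_sum, eval_finsetSum, hc]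
  have hcoeff : (∑ i ∈ Finset.range (n + 1), C (c i) * X ^ (2 * i)).coeff (2 * j) = c j := by
    simp only [finsetSum_coeff, coeff_C_mul_X_pow]
    rw [Finset.sum_eq_single j]
    · simp
    · intro i _ hi
      rw [if_neg (by omega)]
    · intro h
      exact absurd (Finset.mem_range.mpr (by omega)) h
  rw [hS, iteratedDeriv_eval_sub, hcoeff, hc]
  ring

theorem stmt16 (n : ℕ) (hn : 0 < n) (j : ℕ) (hj : j ≤ n) :
    iteratedDeriv (2 * j) (Sb n) (1 / 2)
      = (Nat.factorial (2 * j) : ℝ) * (4 : ℝ) ^ ((j : ℤ) - (n : ℤ))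
        * (Nat.choose (2 * n) n : ℝ) * (Nat.choose n j : ℝ) ^ 2
        * (Nat.choose (2 * n) (2 * j) : ℝ)⁻¹ ∧
    0 < iteratedDeriv (2 * j) (Sb n) (1 / 2) := by
  refine ⟨iteratedDeriv_two_mul_Sb hj, ?_⟩
  rw [iteratedDeriv_two_mul_Sb hj]
  have h1 : 0 < (2 * n).choose n := Nat.choose_pos (by omega)
  have h2 : 0 < n.choose j := Nat.choose_pos hj
  have h3 : 0 < (2 * n).choose (2 * j) := Nat.choose_pos (by omega)
  positivity
end
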